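/- Let G be 3-edge-connected with DFS tree T rooted at r, and let v ≠ r be a vertex for which nextM(v) exists, say w = nextM(v). Then w is a proper ancestor of v and B(w) is a proper subset of B(v). -/

import Mathlib

/-- An undirected multigraph `G` (parallel edges allowed, no self-loops) together with a
DFS spanning tree `T` rooted at `root`, where the vertices are identified with their DFS
preorder numbers (so they are `Fin n`, and the root gets the smallest number).
Tree edges are oriented from child to parent and back-edges from descendant to
(proper) ancestor. -/
structure DFSGraph where
  /-- number of vertices; the vertices are `Fin n`, numbered in DFS preorder -/
  n : ℕ
  /-- the type indexing the edges (parallel edges are allowed) -/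
  Edge : Type
  edgeFintype : Fintype Edge
  /-- the first endpoint (the descendant end) of each edge -/
  fst : Edge → Fin n
  /-- the second endpoint (the ancestor end) of each edge -/
  snd : Edge → Fin n
  /-- no self-loops -/
  noloop : ∀ e, fst e ≠ snd e
  /-- the root `r` of the DFS tree -/
  root : Fin n
  /-- in DFS preorder the root gets the smallest number -/
  root_le : ∀ v, root ≤ v
  /-- the parent function `p` of the DFS tree (arbitrary at the root) -/
  parent : Fin n → Fin n
  /-- the parent of a non-root vertex precedes it in preorder -/
  parent_lt : ∀ v, v ≠ root → parent v < v
  /-- `tEdge v` is the tree edge `(v, p(v))`, for `v ≠ root` -/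
  tEdge : Fin n → Edge
  tEdge_fst : ∀ v, v ≠ root → fst (tEdge v) = v
  tEdge_snd : ∀ v, v ≠ root → snd (tEdge v) = parent v
  tEdge_inj : ∀ u v, u ≠ root → v ≠ root → tEdge u = tEdge v → u = v
  /-- DFS property: every non-tree edge is a back-edge, i.e. it joins a vertex to an
  ancestor of it (a proper ancestor, by `noloop`) -/
  back_anc : ∀ e, (¬ ∃ v, v ≠ root ∧ e = tEdge v) →
    Relation.ReflTransGen (fun x y => x ≠ root ∧ y = parent x) (fst e) (snd e)
  /-- preorder property: the descendants of any vertex form an interval of preorder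
  numbers starting at that vertex -/
  preorder_interval : ∀ v u w : Fin n, v ≤ u → u ≤ w →
    Relation.ReflTransGen (fun x y => x ≠ root ∧ y = parent x) w v →
    Relation.ReflTransGen (fun x y => x ≠ root ∧ y = parent x) u v

namespace DFSGraph

variable (G : DFSGraph)

/-- `Anc a b`: `a` is an ancestor of `b` in `T` (every vertex is an ancestor of itself). -/
def Anc (a b : Fin G.n) : Prop :=
  Relation.ReflTransGen (fun x y => x ≠ G.root ∧ y = G.parent x) b a

/-- `PAnc a b`: `a` is a proper ancestor of `b` in `T`. -/
def PAnc (a b : Fin G.n) : Prop := G.Anc a b ∧ a ≠ b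

/-- `e` is an edge of the spanning tree `T`. -/
def IsTreeEdge (e : G.Edge) : Prop := ∃ v, v ≠ G.root ∧ e = G.tEdge v

/-- `e` is a back-edge (an edge of `G ∖ T`). -/
def IsBack (e : G.Edge) : Prop := ¬ G.IsTreeEdge e

/-- `B v`: the set of back-edges `(x, y)` with `x` a descendant of `v` and `y` a proper
ancestor of `v`. -/
def B (v : Fin G.n) : Set G.Edge :=
  {e | G.IsBack e ∧ G.Anc v (G.fst e) ∧ G.PAnc (G.snd e) v}

/-- `b_count(v) = |B(v)|`. -/
noncomputable def bcount (v : Fin G.n) : ℕ := (G.B v).ncard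

/-- adjacency in `G` after removing the edge set `S` -/
def AdjOff (S : Set G.Edge) (x y : Fin G.n) : Prop :=
  ∃ e, e ∉ S ∧ ((G.fst e = x ∧ G.snd e = y) ∨ (G.fst e = y ∧ G.snd e = x))

/-- `G ∖ S` is connected -/
def ConnectedOff (S : Set G.Edge) : Prop :=
  ∀ x y, Relation.ReflTransGen (G.AdjOff S) x y

/-- `S` is an edge cut of `G`: removing `S` disconnects `G`. -/
def IsCut (S : Set G.Edge) : Prop := ¬ G.ConnectedOff S

/-- `G` is `k`-edge-connected: it has no cut of fewer than `k` edges. -/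
def EdgeConn (k : ℕ) : Prop := ∀ S : Set G.Edge, S.ncard < k → ¬ G.IsCut S

/-- `IsLow1 v y`: `y = low1(v) = min {y | ∃ (x,y) ∈ B(v)}`. -/
def IsLow1 (v y : Fin G.n) : Prop :=
  (∃ e ∈ G.B v, G.snd e = y) ∧ ∀ e ∈ G.B v, y ≤ G.snd e

/-- `IsHigh v y`: `y = high(v) = max {y | ∃ (x,y) ∈ B(v)}`. -/
def IsHigh (v y : Fin G.n) : Prop :=
  (∃ e ∈ G.B v, G.snd e = y) ∧ ∀ e ∈ G.B v, G.snd e ≤ y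

/-- `IsLow2 v y`: `y = low2(v)`, the minimum lower end of the back-edges in `B(v)` minus
one (fixed, but arbitrary) back-edge `(low1D(v), low1(v))` attaining `low1(v)`. -/
def IsLow2 (v y : Fin G.n) : Prop :=
  ∃ f ∈ G.B v, (∀ g ∈ G.B v, G.snd f ≤ G.snd g) ∧
    (∃ e ∈ G.B v, e ≠ f ∧ G.snd e = y) ∧
    (∀ e ∈ G.B v, e ≠ f → y ≤ G.snd e)

/-- `IsL1 v y`: `y = l1(v) = min ({y | (v,y) is a back-edge} ∪ {v})`. -/
def IsL1 (v y : Fin G.n) : Prop :=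
  (y = v ∨ ∃ e, G.IsBack e ∧ G.fst e = v ∧ G.snd e = y) ∧
  y ≤ v ∧ (∀ e, G.IsBack e → G.fst e = v → y ≤ G.snd e)

/-- `IsL2 v y`: `y = l2(v)`, defined as `l1(v)` but after removing one (fixed, but
arbitrary) back-edge `(v, l1(v))` attaining `l1(v)`, if such a back-edge exists. -/
def IsL2 (v y : Fin G.n) : Prop :=
  ((¬ ∃ e, G.IsBack e ∧ G.fst e = v) ∧ y = v) ∨
  (∃ f, G.IsBack f ∧ G.fst f = v ∧
    (∀ g, G.IsBack g → G.fst g = v → G.snd f ≤ G.snd g) ∧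
    (y = v ∨ ∃ e, G.IsBack e ∧ G.fst e = v ∧ e ≠ f ∧ G.snd e = y) ∧
    y ≤ v ∧
    (∀ e, G.IsBack e → G.fst e = v → e ≠ f → y ≤ G.snd e))

/-- `z` is the nearest common ancestor of the set of vertices `S`. -/
def IsNCA (S : Set (Fin G.n)) (z : Fin G.n) : Prop :=
  (∀ x ∈ S, G.Anc z x) ∧ ∀ z', (∀ x ∈ S, G.Anc z' x) → G.Anc z' z

/-- `IsM v m`: `m = M(v)`, the nearest common ancestor of all higher ends of back-edges
in `B(v)`. -/
def IsM (v m : Fin G.n) : Prop :=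
  G.IsNCA {x | ∃ e ∈ G.B v, G.fst e = x} m

/-- `IsMtilde v m`: `m = M̃(v)`, the nearest common ancestor of all higher ends of
back-edges in `B(v)` that are proper descendants of `M(v)` (defined only if such a
higher end exists). -/
def IsMtilde (v m : Fin G.n) : Prop :=
  ∃ mv, G.IsM v mv ∧
    {x | ∃ e ∈ G.B v, G.fst e = x ∧ G.PAnc mv x}.Nonempty ∧
    G.IsNCA {x | ∃ e ∈ G.B v, G.fst e = x ∧ G.PAnc mv x} m

/-- `c` is a child of `p` in `T`. -/
def IsChild (p c : Fin G.n) : Prop := c ≠ G.root ∧ G.parent c = p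

/-- `low1(c) ≤ low1(c')` (stated relationally). -/
def Low1LE (c c' : Fin G.n) : Prop :=
  ∀ y y', G.IsLow1 c y → G.IsLow1 c' y' → y ≤ y'

/-- `c = c₁(p)`: `c` is a `low1` child of `p`, i.e. a child of `p` minimizing `low1`. -/
def IsC1 (p c : Fin G.n) : Prop :=
  G.IsChild p c ∧ ∀ c', G.IsChild p c' → G.Low1LE c c'

/-- `c = c₂(p)`: `c` is a `low2` child of `p`, i.e. a child of `p` minimizing `low1`
among the children different from the (fixed) `low1` child. -/
def IsC2 (p c : Fin G.n) : Prop :=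
  ∃ c1, G.IsC1 p c1 ∧ G.IsChild p c ∧ c ≠ c1 ∧
    ∀ c', G.IsChild p c' → c' ≠ c1 → G.Low1LE c c'

/-- `c = c₃(p)`: `c` is a `low3` child of `p`. -/
def IsC3 (p c : Fin G.n) : Prop :=
  ∃ c1 c2, G.IsC1 p c1 ∧
    (G.IsChild p c2 ∧ c2 ≠ c1 ∧ ∀ c', G.IsChild p c' → c' ≠ c1 → G.Low1LE c2 c') ∧
    G.IsChild p c ∧ c ≠ c1 ∧ c ≠ c2 ∧
    (∀ c', G.IsChild p c' → c' ≠ c1 → c' ≠ c2 → G.Low1LE c c')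

/-- `IsMlow1 v m`: `m = M_low1(v)`, the nearest common ancestor of all higher ends of
back-edges in `B(v)` that are descendants of the `low1` child of `M(v)` (defined only
if such a higher end exists). -/
def IsMlow1 (v m : Fin G.n) : Prop :=
  ∃ mv c1, G.IsM v mv ∧ G.IsC1 mv c1 ∧
    {x | ∃ e ∈ G.B v, G.fst e = x ∧ G.Anc c1 x}.Nonempty ∧
    G.IsNCA {x | ∃ e ∈ G.B v, G.fst e = x ∧ G.Anc c1 x} m

/-- `IsMlow2 v m`: `m = M_low2(v)`, the nearest common ancestor of all higher ends of
back-edges in `B(v)` that are descendants of the `low2` child of `M(v)` (defined only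
if such a higher end exists). -/
def IsMlow2 (v m : Fin G.n) : Prop :=
  ∃ mv c2, G.IsM v mv ∧ G.IsC2 mv c2 ∧
    {x | ∃ e ∈ G.B v, G.fst e = x ∧ G.Anc c2 x}.Nonempty ∧
    G.IsNCA {x | ∃ e ∈ G.B v, G.fst e = x ∧ G.Anc c2 x} m

/-- `IsNextM v w`: `w = nextM(v)`, the maximum vertex `w < v` with `M(w) = M(v)`. -/
def IsNextM (v w : Fin G.n) : Prop :=
  ∃ m, G.IsM v m ∧ G.IsM w m ∧ w < v ∧ ∀ w', w' < v → G.IsM w' m → w' ≤ w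

/-- `IsLowM v l`: `l = low_M(v) = min {y | ∃ (x,y) ∈ B(v) ∖ B(nextM(v))}`. -/
def IsLowM (v l : Fin G.n) : Prop :=
  ∃ w, G.IsNextM v w ∧ (∃ e ∈ G.B v, e ∉ G.B w ∧ G.snd e = l) ∧
    ∀ e ∈ G.B v, e ∉ G.B w → l ≤ G.snd e

end DFSGraph

namespace DFSGraph

variable {G : DFSGraph}

theorem Anc.trans {a b c : Fin G.n} (h₁ : G.Anc a b) (h₂ : G.Anc b c) : G.Anc a c :=
  Relation.ReflTransGen.trans h₂ h₁

theorem Anc.le {a b : Fin G.n} (h : G.Anc a b) : a ≤ b := by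
  unfold Anc at h
  induction h with
  | refl => exact le_rfl
  | tail _ h ih =>
    obtain ⟨hr, rfl⟩ := h
    exact (G.parent_lt _ hr).le.trans ih

theorem Anc.antisymm {a b : Fin G.n} (h₁ : G.Anc a b) (h₂ : G.Anc b a) : a = b :=
  le_antisymm h₁.le h₂.le

/-- Two ancestors of the same vertex are comparable. -/
theorem Anc.total {a b c : Fin G.n} (ha : G.Anc a c) (hb : G.Anc b c) :
    G.Anc a b ∨ G.Anc b a :=
  (Relation.ReflTransGen.total_of_right_unique
    (fun _ _ _ h₁ h₂ => h₁.2.trans h₂.2.symm) ha hb).symm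

theorem anc_parent_iff {u v : Fin G.n} (hu : u ≠ G.root) (huv : u ≠ v) :
    G.Anc v (G.parent u) ↔ G.Anc v u := by
  refine ⟨Relation.ReflTransGen.head ⟨hu, rfl⟩, fun h => ?_⟩
  rcases Relation.ReflTransGen.cases_head h with rfl | ⟨_, ⟨_, rfl⟩, h⟩
  · exact absurd rfl huv
  · exact h

theorem IsBack.anc {e : G.Edge} (he : G.IsBack e) : G.Anc (G.snd e) (G.fst e) :=
  G.back_anc e he

theorem IsBack.mem_B_iff {e : G.Edge} (he : G.IsBack e) {v : Fin G.n} :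
    e ∈ G.B v ↔ G.Anc v (G.fst e) ∧ ¬ G.Anc v (G.snd e) := by
  constructor
  · rintro ⟨-, h, hs, hne⟩
    exact ⟨h, fun h' => hne (hs.antisymm h')⟩
  · rintro ⟨h, hn⟩
    refine ⟨he, h, (he.anc.total h).resolve_right hn, ?_⟩
    rintro rfl
    exact hn Relation.ReflTransGen.refl

theorem IsM.anc {v m : Fin G.n} (h : G.IsM v m) : G.Anc v m :=
  h.2 v fun _ ⟨_, he, hx⟩ => hx ▸ he.2.1

/-- A set of vertices that is closed under adjacency outside fewer than `k` edges is trivial. -/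
theorem EdgeConn.of_invariant {k : ℕ} (hk : G.EdgeConn k) {S : Set G.Edge} (hS : S.ncard < k)
    {P : Fin G.n → Prop} (hP : ∀ e ∉ S, P (G.fst e) ↔ P (G.snd e)) {x y : Fin G.n}
    (hx : P x) : P y := by
  have hconn : Relation.ReflTransGen (G.AdjOff S) x y := not_not.mp (hk S hS) x y
  induction hconn with
  | refl => exact hx
  | tail _ h ih =>
    obtain ⟨e, he, ⟨rfl, rfl⟩ | ⟨rfl, rfl⟩⟩ := h
    · exact (hP e he).1 ih
    · exact (hP e he).2 ih

theorem EdgeConn.B_ne_of_pAnc (h3 : G.EdgeConn 3) {v w : Fin G.n} (h : G.PAnc w v) :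
    G.B w ≠ G.B v := by
  intro hB
  have hS : ({G.tEdge v, G.tEdge w} : Set G.Edge).ncard < 3 :=
    (Set.ncard_insert_le _ _).trans_lt (by simp)
  have key : G.Anc w v ∧ ¬ G.Anc v v := by
    refine h3.of_invariant hS (P := fun x => G.Anc w x ∧ ¬ G.Anc v x) (x := w) ?_
      ⟨Relation.ReflTransGen.refl, fun h' => h.2 (h.1.antisymm h')⟩
    intro e he
    by_cases ht : G.IsTreeEdge e
    · obtain ⟨u, hu, rfl⟩ := ht
      have huv : u ≠ v := by rintro rfl; simp at he
      have huw : u ≠ w := by rintro rfl; simp at he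
      simp only [G.tEdge_fst u hu, G.tEdge_snd u hu, anc_parent_iff hu huv,
        anc_parent_iff hu huw]
    · have hb : G.IsBack e := ht
      have hwv := hb.mem_B_iff (v := w)
      rw [hB, hb.mem_B_iff] at hwv
      have hw : G.Anc w (G.snd e) → G.Anc w (G.fst e) := fun h' => h'.trans hb.anc
      have hv : G.Anc v (G.snd e) → G.Anc v (G.fst e) := fun h' => h'.trans hb.anc
      have hf : G.Anc v (G.fst e) → G.Anc w (G.fst e) := h.1.trans
      have hs : G.Anc v (G.snd e) → G.Anc w (G.snd e) := h.1.trans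
      tauto
  exact key.2 Relation.ReflTransGen.refl

theorem B_subset_of_anc_of_isM {v w m : Fin G.n} (h : G.Anc w v) (hv : G.IsM v m)
    (hw : G.IsM w m) : G.B w ⊆ G.B v := by
  rintro e he
  refine ⟨he.1, hv.anc.trans (hw.1 _ ⟨e, he, rfl⟩), he.2.2.1.trans h, fun hs => ?_⟩
  exact he.2.2.2 (he.2.2.1.antisymm (hs ▸ h))

end DFSGraph

/-- Let `G` be `3`-edge-connected with DFS tree `T` rooted at `r`, and
let `v ≠ r` be a vertex for which `nextM(v)` exists, say `w = nextM(v)`. Then `w` is a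
proper ancestor of `v` and `B(w)` is a proper subset of `B(v)`. -/
theorem stmt13 (G : DFSGraph) (h3 : G.EdgeConn 3) (v w : Fin G.n)
    (hv : v ≠ G.root) (hw : G.IsNextM v w) :
    G.PAnc w v ∧ G.B w ⊂ G.B v := by
  obtain ⟨m, hvm, hwm, hlt, -⟩ := hw
  have h : G.PAnc w v :=
    ⟨(hwm.anc.total hvm.anc).resolve_right fun h' => hlt.not_ge h'.le, hlt.ne⟩
  exact ⟨h, (DFSGraph.B_subset_of_anc_of_isM h.1 hvm hwm).ssubset_of_ne (h3.B_ne_of_pAnc h)⟩
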